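/- arXiv:2309.03030 — 3 statements merged into one kernel-verified Lean document; each statement's English description precedes it below -/
import Mathlib

section
/- Let Γ = G *_φ H be the free product of groups G and H with subgroups A ≤ G and B ≤ H amalgamated via an isomorphism φ : A → B. Let G' ≤ G and H' ≤ H be subgroups such that φ(G' ∩ A) = H' ∩ B. Then for the subgroup Γ' = ⟨G', H'⟩ of Γ generated by the canonical images of G' and H', one has Γ' ∩ G = G' and Γ' ∩ H = H' (as subgroups of Γ, identifying G, H, G', H' with their canonical images). -/
open Monoid

/-- The free product of `G` and `H` with amalgamation along the homomorphisms
`i : A →* G` and `j : A →* H`: the quotient of the free product `G * H` by the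
normal closure of the elements `j a * (i a)⁻¹`. -/
abbrev Amalg {A G H : Type} [Group A] [Group G] [Group H] (i : A →* G) (j : A →* H) : Type :=
  (Coprod G H) ⧸ Subgroup.normalClosure
    {x : Coprod G H | ∃ a : A, x = Coprod.inr (j a) * (Coprod.inl (i a))⁻¹}

/-- The canonical homomorphism of `G` into the amalgamated product. -/
def Amalg.inl {A G H : Type} [Group A] [Group G] [Group H] (i : A →* G) (j : A →* H) :
    G →* Amalg i j :=
  (QuotientGroup.mk' _).comp Coprod.inl

/-- The canonical homomorphism of `H` into the amalgamated product. -/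
def Amalg.inr {A G H : Type} [Group A] [Group G] [Group H] (i : A →* G) (j : A →* H) :
    H →* Amalg i j :=
  (QuotientGroup.mk' _).comp Coprod.inr

namespace AmalgAux

open Monoid.CoprodI Monoid.PushoutI

section General

variable {ι : Type} {K : ι → Type} {A : Type} [∀ i, Group (K i)] [Group A]
  (f : ∀ i, A →* K i) (S : ∀ i, Subgroup (K i))

/-- `x` is a product of an element of `S i` and a reduced word with letters in the `S j`
not beginning with a letter from `K i`. -/
def Good (i : ι) (x : PushoutI f) : Prop :=
  ∃ g ∈ S i, ∃ w : Word K, w.fstIdx ≠ some i ∧ Reduced f w ∧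
    (∀ l ∈ w.toList, l.2 ∈ S l.1) ∧ x = PushoutI.of i g * ofCoprodI w.prod

variable {f S}

theorem Good.change (hS : ∀ a i j, f i a ∈ S i → f j a ∈ S j) {i j : ι} {x : PushoutI f}
    (h : Good f S i x) : Good f S j x := by
  classical
  by_cases hij : i = j
  · exact hij ▸ h
  obtain ⟨g, hg, w, hw1, hw2, hw3, rfl⟩ := h
  by_cases hA : g ∈ (f i).range
  · obtain ⟨a, rfl⟩ := hA
    have hj := hS a i j hg
    induction w using Word.consRecOn with
    | empty =>
      exact ⟨f j a, hj, Word.empty, by simp [Word.fstIdx, Word.empty], hw2, hw3, by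
        rw [of_apply_eq_base, of_apply_eq_base]⟩
    | cons k m w h1 h2 _ =>
      by_cases hk : k = j
      · subst hk
        refine ⟨f k a * m, mul_mem hj (hw3 ⟨k, m⟩ List.mem_cons_self), w, h1,
          fun l hl => hw2 l (List.mem_cons_of_mem _ hl),
          fun l hl => hw3 l (List.mem_cons_of_mem _ hl), ?_⟩
        rw [Word.prod_cons, map_mul, map_mul, ofCoprodI_of, of_apply_eq_base, of_apply_eq_base,
          mul_assoc]
      · exact ⟨f j a, hj, _, by simpa using hk, hw2, hw3, by
          rw [of_apply_eq_base, of_apply_eq_base]⟩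
  · have h1 : g ≠ 1 := by rintro rfl; exact hA (one_mem _)
    refine ⟨1, one_mem _, Word.cons g w hw1 h1, by simpa using hij, ?_, ?_, ?_⟩
    · intro l hl
      rcases List.mem_cons.1 hl with rfl | hl
      · exact hA
      · exact hw2 l hl
    · intro l hl
      rcases List.mem_cons.1 hl with rfl | hl
      · exact hg
      · exact hw3 l hl
    · rw [Word.prod_cons, map_mul, ofCoprodI_of, map_one, one_mul]

theorem Good.mul (hS : ∀ a i j, f i a ∈ S i → f j a ∈ S j) {i j : ι} {x : PushoutI f}
    (h : Good f S i x) {g : K j} (hg : g ∈ S j) : Good f S i (PushoutI.of j g * x) := by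
  obtain ⟨g', hg', w, h1, h2, h3, rfl⟩ := h.change hS (j := j)
  refine Good.change hS (i := j) ⟨g * g', mul_mem hg hg', w, h1, h2, h3, ?_⟩
  rw [map_mul, mul_assoc]

theorem Good.one (i : ι) : Good f S i 1 :=
  ⟨1, one_mem _, Word.empty, by simp [Word.fstIdx, Word.empty],
    by intro l hl; simp [Word.empty] at hl, by intro l hl; simp [Word.empty] at hl, by simp⟩

theorem Good.mem (hf : ∀ i, Function.Injective (f i)) {i : ι} {g : K i}
    (h : Good f S i (PushoutI.of i g)) : g ∈ S i := by
  obtain ⟨g', hg', w, h1, h2, h3, h⟩ := h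
  have h' : ofCoprodI w.prod = PushoutI.of (φ := f) i (g'⁻¹ * g) := by
    rw [map_mul, h, map_inv, inv_mul_cancel_left]
  by_cases hA : g'⁻¹ * g ∈ (f i).range
  · obtain ⟨a, ha⟩ := hA
    have hw := h2.eq_empty_of_mem_range hf (by
      rw [h', ← ha, of_apply_eq_base]; exact ⟨a, rfl⟩)
    subst hw
    rw [Word.prod_empty, map_one] at h'
    have := of_injective hf i (h'.symm.trans (map_one _).symm)
    rwa [← inv_mul_eq_one.1 this]
  · exfalso
    have hA' : (g'⁻¹ * g)⁻¹ ∉ (f i).range := fun h => hA (by simpa using inv_mem h)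
    have hne : (g'⁻¹ * g)⁻¹ ≠ 1 := fun h => hA' (h ▸ one_mem _)
    have hr : Reduced f (Word.cons (g'⁻¹ * g)⁻¹ w h1 hne) := by
      intro l hl
      rcases List.mem_cons.1 hl with rfl | hl
      · exact hA'
      · exact h2 l hl
    have hw := hr.eq_empty_of_mem_range hf (by
      rw [Word.prod_cons, map_mul, ofCoprodI_of, h', map_inv, inv_mul_cancel]; exact one_mem _)
    simpa [Word.empty, Word.cons] using congrArg Word.toList hw

theorem mem_of_mem_iSup (hf : ∀ i, Function.Injective (f i))
    (hS : ∀ a i j, f i a ∈ S i → f j a ∈ S j) {i : ι} {g : K i}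
    (h : PushoutI.of i g ∈ ⨆ j, (S j).map (PushoutI.of (φ := f) j)) : g ∈ S i := by
  have key : ∀ x ∈ ⨆ j, (S j).map (PushoutI.of (φ := f) j),
      ∀ y, Good f S i y → Good f S i (x * y) := by
    intro x hx
    refine Subgroup.iSup_induction _ (C := fun x => ∀ y, Good f S i y → Good f S i (x * y))
      hx ?_ ?_ ?_
    · rintro j _ ⟨s, hs, rfl⟩ y hy
      exact hy.mul hS hs
    · intro y hy; simpa using hy
    · intro a b ha hb y hy
      rw [mul_assoc]; exact ha _ (hb _ hy)
  have := key _ h 1 (Good.one i)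
  rw [mul_one] at this
  exact this.mem hf

end General

/-- The two factors as a family. -/
def Fam (G H : Type) : Bool → Type
  | true => G
  | false => H

instance (G H : Type) [Group G] [Group H] : ∀ b, Group (Fam G H b)
  | true => inferInstanceAs (Group G)
  | false => inferInstanceAs (Group H)

/-- The two maps as a family. -/
def famMap {A G H : Type} [Group A] [Group G] [Group H] (i : A →* G) (j : A →* H) :
    ∀ b, A →* Fam G H b
  | true => i
  | false => j

/-- The two subgroups as a family. -/
def famSub {G H : Type} [Group G] [Group H] (G' : Subgroup G) (H' : Subgroup H) :
    ∀ b, Subgroup (Fam G H b)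
  | true => G'
  | false => H'

/-- The comparison map to Mathlib's pushout. -/
def toPush {A G H : Type} [Group A] [Group G] [Group H] (i : A →* G) (j : A →* H) :
    Amalg i j →* PushoutI (famMap i j) :=
  QuotientGroup.lift _
    (Coprod.lift (PushoutI.of (φ := famMap i j) true : G →* PushoutI (famMap i j))
      (PushoutI.of (φ := famMap i j) false : H →* PushoutI (famMap i j))) (by
    refine Subgroup.normalClosure_le_normal ?_
    rintro _ ⟨a, rfl⟩
    have h1 := of_apply_eq_base (famMap i j) true a
    have h2 := of_apply_eq_base (famMap i j) false a
    have h3 := h2.trans h1.symm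
    rw [SetLike.mem_coe, MonoidHom.mem_ker, map_mul, map_inv]
    exact mul_inv_eq_one.2 h3)

theorem toPush_inl {A G H : Type} [Group A] [Group G] [Group H] (i : A →* G) (j : A →* H)
    (g : G) : toPush i j (Amalg.inl i j g) = PushoutI.of (φ := famMap i j) true g := rfl

theorem toPush_inr {A G H : Type} [Group A] [Group G] [Group H] (i : A →* G) (j : A →* H)
    (g : H) : toPush i j (Amalg.inr i j g) = PushoutI.of (φ := famMap i j) false g := rfl

theorem toPush_mem {A G H : Type} [Group A] [Group G] [Group H] (i : A →* G) (j : A →* H)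
    (G' : Subgroup G) (H' : Subgroup H) {x : Amalg i j}
    (hx : x ∈ G'.map (Amalg.inl i j) ⊔ H'.map (Amalg.inr i j)) :
    toPush i j x ∈ ⨆ b, (famSub G' H' b).map (PushoutI.of (φ := famMap i j) b) := by
  suffices h : G'.map (Amalg.inl i j) ⊔ H'.map (Amalg.inr i j) ≤
      (⨆ b, (famSub G' H' b).map (PushoutI.of (φ := famMap i j) b)).comap (toPush i j) from h hx
  refine sup_le ?_ ?_
  · rintro _ ⟨g, hg, rfl⟩
    exact Subgroup.mem_iSup_of_mem true ⟨g, hg, rfl⟩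
  · rintro _ ⟨g, hg, rfl⟩
    exact Subgroup.mem_iSup_of_mem false ⟨g, hg, rfl⟩

end AmalgAux

theorem stmt2 (G H : Type) [Group G] [Group H]
    (A : Subgroup G) (B : Subgroup H) (φ : A ≃* B)
    (G' : Subgroup G) (H' : Subgroup H)
    -- `φ` carries `G' ∩ A` exactly onto `H' ∩ B`:
    (hφ : ∀ a : A, (a : G) ∈ G' ↔ ((φ a : H)) ∈ H') :
    -- `Γ' ∩ G = G'` and `Γ' ∩ H = H'` inside `Γ = G *_φ H`
    (G'.map (Amalg.inl A.subtype (B.subtype.comp φ.toMonoidHom)) ⊔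
       H'.map (Amalg.inr A.subtype (B.subtype.comp φ.toMonoidHom))) ⊓
      (Amalg.inl A.subtype (B.subtype.comp φ.toMonoidHom)).range =
      G'.map (Amalg.inl A.subtype (B.subtype.comp φ.toMonoidHom)) ∧
    (G'.map (Amalg.inl A.subtype (B.subtype.comp φ.toMonoidHom)) ⊔
       H'.map (Amalg.inr A.subtype (B.subtype.comp φ.toMonoidHom))) ⊓
      (Amalg.inr A.subtype (B.subtype.comp φ.toMonoidHom)).range =
      H'.map (Amalg.inr A.subtype (B.subtype.comp φ.toMonoidHom)) := by
  have hf : ∀ b, Function.Injective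
      (AmalgAux.famMap A.subtype (B.subtype.comp φ.toMonoidHom) b) := by
    rintro (_ | _)
    · exact Subtype.val_injective.comp φ.injective
    · exact Subtype.val_injective
  have hS : ∀ a b c, AmalgAux.famMap A.subtype (B.subtype.comp φ.toMonoidHom) b a ∈
      AmalgAux.famSub G' H' b → AmalgAux.famMap A.subtype (B.subtype.comp φ.toMonoidHom) c a ∈
      AmalgAux.famSub G' H' c := by
    rintro a (_ | _) (_ | _) h
    · exact h
    · exact (hφ a).2 h
    · exact (hφ a).1 h
    · exact h
  constructor
  · refine le_antisymm ?_ (le_inf le_sup_left (Subgroup.map_le_range _ _))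
    rintro _ ⟨hx, g, rfl⟩
    exact ⟨g, AmalgAux.mem_of_mem_iSup hf hS (i := true) (AmalgAux.toPush_mem _ _ _ _ hx), rfl⟩
  · refine le_antisymm ?_ (le_inf le_sup_right (Subgroup.map_le_range _ _))
    rintro _ ⟨hx, g, rfl⟩
    exact ⟨g, AmalgAux.mem_of_mem_iSup hf hS (i := false) (AmalgAux.toPush_mem _ _ _ _ hx), rfl⟩
end

section
/- Let Γ = G *_A H be the free product of groups G and H amalgamated over a common subgroup A, and let G' ≤ G and H' ≤ H be subgroups with G' ∩ A = H' ∩ A = {1} (trivial). Then: (1) the subgroup Γ' = ⟨G', H'⟩ of Γ is naturally isomorphic to the ordinary free product G' * H'; and (2) if moreover G' is a free group of rank m and H' is a free group of rank n, then Γ' is a free group of rank m + n. -/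
open Monoid

theorem lift_inj_aux {ι A : Type} {K : ι → Type} [Group A] [∀ b, Group (K b)]
    (φ : ∀ b, A →* K b) (hφ : ∀ b, Function.Injective (φ b))
    (S : ∀ b, Subgroup (K b)) (hS : ∀ b, (S b).comap (φ b) = ⊥) :
    Function.Injective (CoprodI.lift (fun b => (PushoutI.of (φ := φ) b).comp (S b).subtype)) := by
  classical
  rw [injective_iff_map_eq_one]
  intro x hx
  obtain ⟨w, rfl⟩ : ∃ w : CoprodI.Word (fun b => S b), w.prod = x :=
    ⟨CoprodI.Word.equiv x, CoprodI.Word.equiv.symm_apply_apply x⟩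
  let w' : CoprodI.Word K :=
    { toList := w.toList.map (fun p => ⟨p.1, (p.2 : K p.1)⟩)
      ne_one := by
        intro l hl
        obtain ⟨p, hp, rfl⟩ := List.mem_map.1 hl
        have := w.ne_one p hp
        simpa using this
      chain_ne := by
        rw [List.isChain_map]
        exact w.chain_ne }
  have hred : PushoutI.Reduced φ w' := by
    intro l hl
    obtain ⟨p, hp, rfl⟩ := List.mem_map.1 hl
    rintro ⟨a, ha⟩
    have h1 : a ∈ (S p.1).comap (φ p.1) := by
      rw [Subgroup.mem_comap, ha]; exact p.2.2
    rw [hS, Subgroup.mem_bot] at h1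
    subst h1
    apply w.ne_one p hp
    ext
    simpa using ha.symm
  have hprod : PushoutI.ofCoprodI (φ := φ) w'.prod =
      CoprodI.lift (fun b => (PushoutI.of (φ := φ) b).comp (S b).subtype) w.prod := by
    simp only [CoprodI.Word.prod, map_list_prod, List.map_map, w']
    congr 1
  have he : w' = CoprodI.Word.empty := by
    apply hred.eq_empty_of_mem_range hφ
    rw [hprod, hx]
    exact one_mem _
  have : w.toList = [] := by
    have := congrArg CoprodI.Word.toList he
    simpa [w', CoprodI.Word.empty] using this
  simp [CoprodI.Word.prod, this]

/-- The two-element family of groups. -/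
abbrev Fam (G H : Type) (b : Bool) : Type := match b with
  | false => G
  | true => H

instance famGroup (G H : Type) [Group G] [Group H] : ∀ b, Group (Fam G H b)
  | false => inferInstanceAs (Group G)
  | true => inferInstanceAs (Group H)

theorem part_one {A G H : Type} [Group A] [Group G] [Group H]
    (i : A →* G) (j : A →* H)
    (hi : Function.Injective i) (hj : Function.Injective j)
    (G' : Subgroup G) (H' : Subgroup H)
    (hG'A : G'.comap i = ⊥) (hH'A : H'.comap j = ⊥) :
    Function.Injective (Coprod.lift ((Amalg.inl i j).comp G'.subtype)
      ((Amalg.inr i j).comp H'.subtype)) := by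
  let φ : ∀ b, A →* Fam G H b := fun b => match b with
    | false => i
    | true => j
  let S : ∀ b, Subgroup (Fam G H b) := fun b => match b with
    | false => G'
    | true => H'
  have key := lift_inj_aux φ (by rintro (_|_) <;> assumption) S (by rintro (_|_) <;> assumption)
  let fG : G →* PushoutI φ := PushoutI.of (φ := φ) false
  let fH : H →* PushoutI φ := PushoutI.of (φ := φ) true
  let q : Amalg i j →* PushoutI φ := QuotientGroup.lift _ (Coprod.lift fG fH) (by
    · apply Subgroup.normalClosure_le_normal
      rintro x ⟨a, rfl⟩
      have h1 : fG (i a) = PushoutI.base φ a := PushoutI.of_apply_eq_base φ false a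
      have h2 : fH (j a) = PushoutI.base φ a := PushoutI.of_apply_eq_base φ true a
      simp [MonoidHom.mem_ker, h1, h2])
  let cG : G' →* CoprodI (fun b => S b) := CoprodI.of (M := fun b => S b) (i := false)
  let cH : H' →* CoprodI (fun b => S b) := CoprodI.of (M := fun b => S b) (i := true)
  let e : Coprod G' H' →* CoprodI (fun b => S b) := Coprod.lift cG cH
  let df : ∀ b, S b →* Coprod G' H' := fun b => match b with
    | false => (Coprod.inl : G' →* Coprod G' H')
    | true => (Coprod.inr : H' →* Coprod G' H')
  let d : CoprodI (fun b => S b) →* Coprod G' H' := CoprodI.lift df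
  let pf : ∀ b, S b →* PushoutI φ := fun b => (PushoutI.of (φ := φ) b).comp (S b).subtype
  have hde : d.comp e = MonoidHom.id _ := by
    apply Coprod.hom_ext
    · ext x
      exact CoprodI.lift_of (M := fun b => S b) df (i := false) x
    · ext x
      exact CoprodI.lift_of (M := fun b => S b) df (i := true) x
  have he : Function.Injective e :=
    Function.LeftInverse.injective (g := d) (fun x => DFunLike.congr_fun hde x)
  have hcomp : q.comp (Coprod.lift ((Amalg.inl i j).comp G'.subtype)
      ((Amalg.inr i j).comp H'.subtype)) =
      (CoprodI.lift (fun b => (PushoutI.of (φ := φ) b).comp (S b).subtype)).comp e := by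
    apply Coprod.hom_ext
    · ext x
      trans fG x
      · simp [q, Amalg.inl]
      · exact (CoprodI.lift_of (M := fun b => S b) pf (i := false) x).symm
    · ext x
      trans fH x
      · simp [q, Amalg.inr]
      · exact (CoprodI.lift_of (M := fun b => S b) pf (i := true) x).symm
  have : Function.Injective (q.comp (Coprod.lift ((Amalg.inl i j).comp G'.subtype)
      ((Amalg.inr i j).comp H'.subtype))) := by
    rw [hcomp]
    exact key.comp he
  exact Function.Injective.of_comp this

/-- The free product of free groups is free. -/
def coprodFree (α β : Type) : Coprod (FreeGroup α) (FreeGroup β) ≃* FreeGroup (α ⊕ β) :=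
  MonoidHom.toMulEquiv
    (Coprod.lift (FreeGroup.map Sum.inl) (FreeGroup.map Sum.inr))
    (FreeGroup.lift (Sum.elim (fun a => Coprod.inl (FreeGroup.of a))
      (fun b => Coprod.inr (FreeGroup.of b))))
    (by apply Coprod.hom_ext <;> ext <;> simp)
    (by ext (x|x) <;> simp)

theorem stmt4 (A G H : Type) [Group A] [Group G] [Group H]
    -- `A` is a common subgroup of `G` and `H`, embedded via `i` and `j`:
    (i : A →* G) (j : A →* H)
    (hi : Function.Injective i) (hj : Function.Injective j)
    (G' : Subgroup G) (H' : Subgroup H)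
    -- `G' ∩ A = H' ∩ A = {1}`:
    (hG'A : G'.comap i = ⊥) (hH'A : H'.comap j = ⊥) :
    -- (1) `Γ' = ⟨G', H'⟩` is naturally isomorphic to the ordinary free product `G' * H'`:
    (∃ ψ : Coprod ↥G' ↥H' →* Amalg i j,
      ψ.comp Coprod.inl = (Amalg.inl i j).comp G'.subtype ∧
      ψ.comp Coprod.inr = (Amalg.inr i j).comp H'.subtype ∧
      Function.Injective ψ ∧
      ψ.range = G'.map (Amalg.inl i j) ⊔ H'.map (Amalg.inr i j)) ∧
    -- (2) if `G'` is free of rank `m` and `H'` is free of rank `n`,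
    --     then `Γ'` is free of rank `m + n`:
    (∀ m n : ℕ, Nonempty (↥G' ≃* FreeGroup (Fin m)) → Nonempty (↥H' ≃* FreeGroup (Fin n)) →
      Nonempty (↥(G'.map (Amalg.inl i j) ⊔ H'.map (Amalg.inr i j)) ≃*
        FreeGroup (Fin (m + n)))) := by
  have hinj := part_one i j hi hj G' H' hG'A hH'A
  have hrange : (Coprod.lift ((Amalg.inl i j).comp G'.subtype)
      ((Amalg.inr i j).comp H'.subtype)).range =
      G'.map (Amalg.inl i j) ⊔ H'.map (Amalg.inr i j) := by
    rw [Coprod.range_lift, MonoidHom.range_comp, MonoidHom.range_comp, Subgroup.range_subtype,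
      Subgroup.range_subtype]
  refine ⟨⟨_, Coprod.lift_comp_inl _ _, Coprod.lift_comp_inr _ _, hinj, hrange⟩, ?_⟩
  rintro m n ⟨e₁⟩ ⟨e₂⟩
  rw [← hrange]
  exact ⟨(MonoidHom.ofInjective hinj).symm.trans ((MulEquiv.coprodCongr e₁ e₂).trans
    ((coprodFree _ _).trans (FreeGroup.freeGroupCongr finSumFinEquiv)))⟩
end

section
/- If A_1, …, A_r are benign subgroups of a finitely generated group G, then their join J = ⟨⋃_{i=1}^r A_i⟩ (the subgroup of G generated by their union) is also a benign subgroup of G. -/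
/-- A group is finitely presented if it admits a presentation with finitely many
generators and finitely many defining relations. -/
def FinitelyPresentedGroup (G : Type) [Group G] : Prop :=
  ∃ (n : ℕ) (S : Finset (FreeGroup (Fin n))),
    Nonempty (G ≃* (FreeGroup (Fin n) ⧸ Subgroup.normalClosure (S : Set (FreeGroup (Fin n)))))

/-- A subgroup `H` of a group `G` is *benign* in `G` if there are a finitely presented
group `K`, an embedding `ι : G →* K` and a finitely generated subgroup `L ≤ K` such
that, identifying `G` and `H` with their images in `K`, one has `G ∩ L = H`. -/
def Benign {G : Type} [Group G] (H : Subgroup G) : Prop :=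
  ∃ (K : Type) (_ : Group K) (ι : G →* K) (L : Subgroup K),
    Function.Injective ι ∧ FinitelyPresentedGroup K ∧ L.FG ∧ ι.range ⊓ L = H.map ι

open Monoid in
theorem pushout_comap_of {ι H : Type} {G : ι → Type} [∀ i, Group (G i)] [Group H]
    (φ : ∀ i, H →* G i) (hφ : ∀ i, Function.Injective (φ i))
    (S : ∀ i, Subgroup (G i)) (J : Subgroup H) (hS : ∀ i, (S i).comap (φ i) = J) (i : ι) :
    (⨆ j, (S j).map (PushoutI.of (φ := φ) j)).comap (PushoutI.of i) = S i := by
  classical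
  apply le_antisymm
  swap
  · intro x hx
    exact (le_iSup (fun j => (S j).map (PushoutI.of (φ := φ) j)) i) ⟨x, hx, rfl⟩
  have hJ : ∀ i (j : J), φ i j ∈ S i := fun i j =>
    (hS i).symm.le j.2
  let ψ : ∀ i, J →* S i := fun i => ((φ i).comp J.subtype).codRestrict (S i) (hJ i)
  have hψ : ∀ i, Function.Injective (ψ i) := by
    intro i a b hab
    apply Subtype.ext
    apply hφ i
    exact congrArg Subtype.val hab
  let m : PushoutI ψ →* PushoutI φ :=
    PushoutI.lift (fun i => (PushoutI.of i).comp (S i).subtype) ((PushoutI.base φ).comp J.subtype)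
      (by
        intro i
        ext j
        exact PushoutI.of_apply_eq_base φ i j)
  have hm : (⨆ j, (S j).map (PushoutI.of (φ := φ) j)) ≤ m.range := by
    apply iSup_le
    rintro j _ ⟨s, hs, rfl⟩
    exact ⟨PushoutI.of j ⟨s, hs⟩, by simp [m]⟩
  intro x hx
  obtain ⟨q, hq⟩ := hm hx
  obtain ⟨d⟩ := PushoutI.NormalWord.transversal_nonempty ψ hψ
  obtain ⟨e⟩ := PushoutI.NormalWord.transversal_nonempty φ hφ
  obtain ⟨w, rfl⟩ : ∃ w : PushoutI.NormalWord d, w.prod = q :=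
    ⟨PushoutI.NormalWord.equiv q, PushoutI.NormalWord.equiv.symm_apply_apply q⟩
  -- letters of `w` are not in the base
  have hred : ∀ g ∈ w.toList, (g.2 : G g.1) ∉ (φ g.1).range := by
    rintro ⟨k, g⟩ hg ⟨h, hh⟩
    have hhJ : h ∈ J := by
      rw [← hS k]
      show φ k h ∈ S k
      rw [hh]
      exact g.2
    have h1 := w.ne_one _ hg
    have h2 := w.normalized _ _ hg
    apply h1
    have h3 : g = ψ k ⟨h, hhJ⟩ := Subtype.ext hh.symm
    have := (d.compl k).1 (a₁ := (⟨1, one_mem _⟩, ⟨g, h2⟩))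
      (a₂ := (⟨ψ k ⟨h, hhJ⟩, ⟨_, rfl⟩⟩, ⟨1, d.one_mem k⟩)) (by simp [h3])
    simpa using congrArg (fun z => (z.2 : S k)) this
  let w' : CoprodI.Word G :=
    { toList := w.toList.map (fun g => ⟨g.1, g.2⟩)
      ne_one := by
        intro l hl
        obtain ⟨g, hg, rfl⟩ := List.mem_map.1 hl
        intro h
        exact hred g hg ⟨1, by simpa using h.symm⟩
      chain_ne := by
        rw [List.isChain_map]
        exact w.chain_ne }
  have hw' : PushoutI.Reduced φ w' := by
    intro l hl
    obtain ⟨g, hg, rfl⟩ := List.mem_map.1 hl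
    exact hred g hg
  have hprod : m w.prod = PushoutI.base φ w.head * PushoutI.ofCoprodI w'.prod := by
    simp only [PushoutI.NormalWord.prod, map_mul, CoprodI.Word.prod, map_list_prod, w',
      List.map_map]
    congr 1
  set y : G i := (φ i w.head)⁻¹ * x with hy
  have hwy : PushoutI.ofCoprodI (φ := φ) w'.prod = PushoutI.of i y := by
    rw [hy, map_mul, map_inv, PushoutI.of_apply_eq_base, ← hq, hprod]
    group
  suffices hyS : y ∈ S i by
    have : x = φ i w.head * y := by simp [hy]
    rw [this]
    exact mul_mem (hJ i w.head) hyS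
  by_cases hyr : y ∈ (φ i).range
  · obtain ⟨h, hh⟩ := hyr
    have h1 : w' = .empty := hw'.eq_empty_of_mem_range hφ
      ⟨h, by rw [hwy, ← hh, PushoutI.of_apply_eq_base]⟩
    rw [h1] at hwy
    have : y = 1 := by
      apply PushoutI.of_injective hφ i
      rw [← hwy]
      simp
    rw [this]
    exact one_mem _
  · let v : CoprodI.Word G :=
      { toList := [⟨i, y⟩]
        ne_one := by
          intro l hl
          simp only [List.mem_singleton] at hl
          subst hl
          rintro h
          exact hyr ⟨1, by simpa using h.symm⟩
        chain_ne := by simp }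
    have hv : PushoutI.Reduced φ v := by
      intro l hl
      simp only [v, List.mem_singleton] at hl
      subst hl
      exact hyr
    have hvp : PushoutI.ofCoprodI (φ := φ) v.prod = PushoutI.of i y := by
      simp [v, CoprodI.Word.prod]
    obtain ⟨n1, hn1, hn1'⟩ := hv.exists_normalWord_prod_eq e
    obtain ⟨n2, hn2, hn2'⟩ := hw'.exists_normalWord_prod_eq e
    have hn : n1 = n2 := PushoutI.NormalWord.prod_injective (by rw [hn1, hn2, hvp, hwy])
    subst hn
    rw [hn1'] at hn2'
    simp only [v, w', List.map_map, List.map_cons, List.map_nil] at hn2'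
    obtain ⟨⟨k, s⟩, hg⟩ : ∃ g, w.toList = [g] := by
      apply List.length_eq_one_iff.1
      simpa using (congrArg List.length hn2').symm
    rw [hg] at hn2'
    simp at hn2'
    subst hn2'
    have : PushoutI.of (φ := φ) i (s : G i) = PushoutI.of i y := by
      rw [← hwy]
      simp [w', CoprodI.Word.prod, hg]
    rw [← PushoutI.of_injective hφ i this]
    exact s.2

open Monoid in
theorem pushout_fp {H : Type} {G : Bool → Type} [∀ i, Group (G i)] [Group H]
    (φ : ∀ i, H →* G i) (hG : ∀ i, Group.IsFinitelyPresented (G i)) (hH : Group.FG H) :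
    Group.IsFinitelyPresented (PushoutI φ) := by
  obtain ⟨T, hT⟩ := hH.out
  have := hG true
  have := hG false
  let f : Coprod (G false) (G true) →* PushoutI φ := Coprod.lift (PushoutI.of false) (PushoutI.of true)
  let R : Set (Coprod (G false) (G true)) :=
    (fun h => Coprod.inl (φ false h) * (Coprod.inr (φ true h))⁻¹) '' T
  let N := Subgroup.normalClosure R
  let p : Coprod (G false) (G true) →* Coprod (G false) (G true) ⧸ N := QuotientGroup.mk' N
  have hb : (p.comp Coprod.inl).comp (φ false) = (p.comp Coprod.inr).comp (φ true) := by
    apply MonoidHom.eq_of_eqOn_dense hT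
    intro h hh
    have h1 : p (Coprod.inl (φ false h) * (Coprod.inr (φ true h))⁻¹) = 1 :=
      (QuotientGroup.eq_one_iff _).2 (Subgroup.subset_normalClosure ⟨h, hh, rfl⟩)
    rw [map_mul, map_inv, mul_inv_eq_one] at h1
    exact h1
  let g : PushoutI φ →* Coprod (G false) (G true) ⧸ N :=
    PushoutI.lift (fun i => match i with
      | false => p.comp Coprod.inl
      | true => p.comp Coprod.inr) ((p.comp Coprod.inl).comp (φ false))
      (by
        intro i
        cases i
        · rfl
        · exact hb.symm)
  have hgf : g.comp f = p := by
    apply Coprod.hom_ext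
    · ext x
      simp [g, f]
    · ext x
      simp [g, f]
  refine Group.IsFinitelyPresented.of_surjective f ?_ ⟨R, T.finite_toSet.image _, ?_⟩
  · intro x
    show x ∈ f.range
    induction x using PushoutI.induction_on with
    | of i x =>
      cases i
      · exact ⟨Coprod.inl x, by simp [f]⟩
      · exact ⟨Coprod.inr x, by simp [f]⟩
    | base h =>
      exact ⟨Coprod.inl (φ false h), by simp [f, PushoutI.of_apply_eq_base]⟩
    | mul x y hx hy => exact mul_mem hx hy
  · apply le_antisymm
    · apply Subgroup.normalClosure_le_normal
      rintro _ ⟨h, hh, rfl⟩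
      show f _ = 1
      simp [f, PushoutI.of_apply_eq_base]
    · intro x hx
      have : p x = 1 := by
        rw [← hgf, MonoidHom.comp_apply, (show f x = 1 from hx), map_one]
      exact (QuotientGroup.eq_one_iff _).1 this

theorem fp_iff (G : Type) [Group G] : FinitelyPresentedGroup G ↔ Group.IsFinitelyPresented G := by
  constructor
  · rintro ⟨n, S, ⟨e⟩⟩
    have : Finite (S : Set (FreeGroup (Fin n))) := S.finite_toSet
    exact Group.IsFinitelyPresented.equiv
      (G := PresentedGroup (S : Set (FreeGroup (Fin n)))) e.symm
  · intro h
    obtain ⟨n, s, hs, ⟨e⟩⟩ := Group.IsFinitelyPresented.exists_mulEquiv_presentedGroup (G := G)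
    refine ⟨n, hs.toFinset, ⟨?_⟩⟩
    exact e.trans (QuotientGroup.quotientMulEquivOfEq (by rw [hs.coe_toFinset]))

theorem fg_sup {G : Type} [Group G] {A B : Subgroup G} (hA : A.FG) (hB : B.FG) : (A ⊔ B).FG := by
  classical
  obtain ⟨S, rfl⟩ := hA
  obtain ⟨T, rfl⟩ := hB
  exact ⟨S ∪ T, by rw [Finset.coe_union, Subgroup.closure_union]⟩

theorem fg_map {G H : Type} [Group G] [Group H] {A : Subgroup G} (hA : A.FG) (f : G →* H) :
    (A.map f).FG := by
  classical
  obtain ⟨S, rfl⟩ := hA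
  exact ⟨S.image f, by rw [Finset.coe_image, MonoidHom.map_closure]⟩

open Monoid in
theorem benign_bool (G : Type) [Group G] (hG : Group.FG G)
    (A : Bool → Subgroup G) (hA : ∀ i, Benign (A i)) : Benign (⨆ i, A i) := by
  choose K iK ι L hι hK hL hinf using hA
  set J := ⨆ i, A i with hJ
  have hAJ : ∀ b, A b ≤ J := fun b => le_iSup A b
  have hmem : ∀ b g, ι b g ∈ L b ↔ g ∈ A b := by
    intro b g
    constructor
    · intro h
      have : ι b g ∈ (A b).map (ι b) := by
        rw [← hinf]
        exact ⟨⟨g, rfl⟩, h⟩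
      obtain ⟨a, ha, hag⟩ := this
      rw [← hι b hag]
      exact ha
    · intro h
      have : ι b g ∈ (ι b).range ⊓ L b := by
        rw [hinf]
        exact ⟨g, h, rfl⟩
      exact this.2
  let φ : ∀ b, Bool → (L b →* K b) := fun b _ => (L b).subtype
  have hφ : ∀ b c, Function.Injective (φ b c) := fun b c => (L b).subtype_injective
  let D : Bool → Type := fun b => PushoutI (φ b)
  have hD : ∀ b, Group.IsFinitelyPresented (PushoutI (φ b)) := fun b =>
    pushout_fp (φ b) (fun _ => (fp_iff _).1 (hK b)) ((Group.fg_iff_subgroup_fg _).2 (hL b))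
  let ε : ∀ b, G →* PushoutI (φ b) := fun b => (PushoutI.of false).comp (ι b)
  have hε : ∀ b, Function.Injective (ε b) := fun b =>
    (PushoutI.of_injective (hφ b) false).comp (hι b)
  let S' : ∀ b, Bool → Subgroup (K b) := fun b c => match c with
    | false => J.map (ι b)
    | true => (ι b).range
  let S : ∀ b, Subgroup (PushoutI (φ b)) := fun b => ⨆ c, (S' b c).map (PushoutI.of c)
  have hS : ∀ b, (S b).comap (ε b) = J := by
    intro b
    have h := pushout_comap_of (φ b) (hφ b) (S' b) (((A b).map (ι b)).comap (L b).subtype) (by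
      intro c
      ext ⟨l, hl⟩
      cases c
      · constructor
        · rintro ⟨g, hg, hgl⟩
          have hgl : ι b g = l := hgl
          subst hgl
          exact ⟨g, (hmem b g).1 hl, rfl⟩
        · rintro ⟨g, hg, hgl⟩
          exact ⟨g, hAJ b hg, hgl⟩
      · constructor
        · rintro ⟨g, hgl⟩
          have hgl : ι b g = l := hgl
          subst hgl
          exact ⟨g, (hmem b g).1 hl, rfl⟩
        · rintro ⟨g, hg, hgl⟩
          exact ⟨g, hgl⟩) false
    show (S b).comap ((PushoutI.of false).comp (ι b)) = J
    rw [← Subgroup.comap_comap, h]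
    exact Subgroup.comap_map_eq_self_of_injective (hι b) J
  have hT := pushout_comap_of ε hε S J hS false
  have hTb : (⨆ b, (S b).map (PushoutI.of (φ := ε) b)).comap (PushoutI.base ε) = J := by
    rw [← PushoutI.of_comp_eq_base (φ := ε) false, ← Subgroup.comap_comap, hT, hS]
  let M : ∀ b, Subgroup (PushoutI ε) := fun b =>
    ((ι b).range.map (PushoutI.of (φ := φ b) true)).map (PushoutI.of (φ := ε) b)
  have hJM : J.map (PushoutI.base ε) ≤ ⨆ b, M b := by
    rw [hJ, Subgroup.map_iSup]
    apply iSup_mono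
    rintro b _ ⟨a, ha, rfl⟩
    refine ⟨PushoutI.of true (ι b a), ⟨ι b a, ⟨a, rfl⟩, rfl⟩, ?_⟩
    rw [← PushoutI.of_apply_eq_base ε b]
    congr 1
    have h1 := PushoutI.of_apply_eq_base (φ b) true ⟨ι b a, (hmem b a).2 ha⟩
    have h2 := PushoutI.of_apply_eq_base (φ b) false ⟨ι b a, (hmem b a).2 ha⟩
    exact h1.trans h2.symm
  have hTM : (⨆ b, (S b).map (PushoutI.of (φ := ε) b)) = ⨆ b, M b := by
    apply le_antisymm
    · apply iSup_le
      intro b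
      rw [Subgroup.map_iSup]
      apply iSup_le
      intro c
      cases c
      · refine le_trans ?_ hJM
        rintro _ ⟨_, ⟨_, ⟨j, hj, rfl⟩, rfl⟩, rfl⟩
        exact ⟨j, hj, (PushoutI.of_apply_eq_base ε b j).symm⟩
      · exact le_iSup M b
    · apply iSup_mono
      intro b
      exact Subgroup.map_mono (le_iSup (fun c => (S' b c).map (PushoutI.of (φ := φ b) c)) true)
  refine ⟨PushoutI ε, inferInstance, PushoutI.base ε, ⨆ b, M b, PushoutI.base_injective hε,
    (fp_iff _).2 (pushout_fp ε hD hG), ?_, ?_⟩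
  · have hM : ∀ b, (M b).FG := fun b =>
      fg_map (fg_map ((Group.fg_iff_subgroup_fg _).1 (Group.fg_range (ι b))) _) _
    rw [iSup_bool_eq]
    exact fg_sup (hM _) (hM _)
  · rw [← hTM, ← hTb, Subgroup.map_comap_eq]

theorem stmt14 (G : Type) [Group G] (hG : Group.FG G)
    (r : ℕ) (hr : 0 < r) (A : Fin r → Subgroup G) (hA : ∀ i, Benign (A i)) :
    Benign (⨆ i, A i) := by
  obtain ⟨n, rfl⟩ : ∃ n, r = n + 1 := ⟨r - 1, by omega⟩
  clear hr
  induction n with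
  | zero =>
    have : ⨆ i, A i = A 0 := by
      apply le_antisymm
      · apply iSup_le
        intro i
        rw [show i = 0 from Fin.ext (by have := i.2; simp at this ⊢)]
      · exact le_iSup A 0
    rw [this]
    exact hA 0
  | succ n ih =>
    have h1 := ih (fun i => A i.succ) (fun i => hA _)
    have : ⨆ i, A i = ⨆ b : Bool, cond b (A 0) (⨆ i : Fin (n + 1), A i.succ) := by
      rw [iSup_bool_eq]
      apply le_antisymm
      · apply iSup_le
        intro i
        refine Fin.cases ?_ (fun j => ?_) i
        · exact le_sup_left
        · exact le_trans (le_iSup (fun j : Fin (n + 1) => A j.succ) j) le_sup_right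
      · apply sup_le
        · exact le_iSup A 0
        · exact iSup_le fun j => le_iSup A j.succ
    rw [this]
    apply benign_bool G hG
    intro b
    cases b
    · exact h1
    · exact hA 0
end
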